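/- Let R be a ring, let P be a class of right R-modules closed under isomorphism, arbitrary direct products and direct summands such that every module in P is a pure submodule of some pure-injective module in P, and let S be the class of left R-modules M whose character module M* belongs to P. Write P⁺ for the class of right R-modules isomorphic to a pure submodule of a member of P. Then the following are equivalent: (i) P⁺ is a definable subcategory of right R-modules; (ii) N* ∈ S for every N ∈ P; (iii) A* ∈ S for every A ∈ P⁺; (iv) S is a definable subcategory and every pure-injective module in P belongs to Prod(S*); (v) S is a definable subcategory and every A ∈ P⁺ is isomorphic to a pure submodule of the character module of some module in S; (vi) S is a definable subcategory and Prod(S*) = Pinj(P). -/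

import Mathlib

universe u

open MulOpposite DirectSum

noncomputable section

/-- The additive group `ℚ/ℤ`. -/
abbrev RatCircle : Type := AddCircle (1 : ℚ)

/-- The character group `Hom_ℤ(M, ℚ/ℤ)` of an abelian group `M`. -/
def Character (M : Type u) [AddCommGroup M] : Type u := M →+ RatCircle

namespace Character

instance instAddCommGroup (M : Type u) [AddCommGroup M] : AddCommGroup (Character M) :=
  inferInstanceAs (AddCommGroup (M →+ RatCircle))

instance instFunLike (M : Type u) [AddCommGroup M] : FunLike (Character M) M RatCircle :=
  inferInstanceAs (FunLike (M →+ RatCircle) M RatCircle)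

instance instAddMonoidHomClass (M : Type u) [AddCommGroup M] :
    AddMonoidHomClass (Character M) M RatCircle :=
  inferInstanceAs (AddMonoidHomClass (M →+ RatCircle) M RatCircle)

@[ext] lemma ext {M : Type u} [AddCommGroup M] {f g : Character M}
    (h : ∀ m, f m = g m) : f = g := DFunLike.ext _ _ h

variable {R : Type u} [Ring R]

/-- If `M` is a left `R`-module then `Character M` is a right `R`-module,
via `(f • r) m = f (r • m)`. -/
instance instSMulRight {M : Type u} [AddCommGroup M] [Module R M] :
    SMul Rᵐᵒᵖ (Character M) where
  smul r f :=
    ((f : M →+ RatCircle).comp (DistribMulAction.toAddMonoidHom M r.unop) : M →+ RatCircle)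

lemma smul_right_apply {M : Type u} [AddCommGroup M] [Module R M]
    (r : Rᵐᵒᵖ) (f : Character M) (m : M) : (r • f) m = f (r.unop • m) := rfl

instance moduleRight {M : Type u} [AddCommGroup M] [Module R M] :
    Module Rᵐᵒᵖ (Character M) where
  one_smul f := ext fun m => by rw [smul_right_apply, unop_one, one_smul]
  mul_smul r s f := ext fun m => by
    rw [smul_right_apply, smul_right_apply, smul_right_apply, unop_mul, mul_smul]
  smul_zero r := ext fun m => rfl
  smul_add r f g := ext fun m => rfl
  add_smul r s f := ext fun m => by
    show f ((r + s).unop • m) = f (r.unop • m) + f (s.unop • m)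
    rw [unop_add, add_smul, map_add]
  zero_smul f := ext fun m => by
    show f ((0 : Rᵐᵒᵖ).unop • m) = 0
    rw [unop_zero, zero_smul, map_zero]

/-- If `M` is a right `R`-module then `Character M` is a left `R`-module,
via `(r • f) m = f (m • r)`. -/
instance instSMulLeft {M : Type u} [AddCommGroup M] [Module Rᵐᵒᵖ M] :
    SMul R (Character M) where
  smul r f :=
    ((f : M →+ RatCircle).comp (DistribMulAction.toAddMonoidHom M (op r)) : M →+ RatCircle)

lemma smul_left_apply {M : Type u} [AddCommGroup M] [Module Rᵐᵒᵖ M]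
    (r : R) (f : Character M) (m : M) : (r • f) m = f (op r • m) := rfl

instance moduleLeft {M : Type u} [AddCommGroup M] [Module Rᵐᵒᵖ M] :
    Module R (Character M) where
  one_smul f := ext fun m => by rw [smul_left_apply, op_one, one_smul]
  mul_smul r s f := ext fun m => by
    rw [smul_left_apply, smul_left_apply, smul_left_apply, op_mul, mul_smul]
  smul_zero r := ext fun m => rfl
  smul_add r f g := ext fun m => rfl
  add_smul r s f := ext fun m => by
    show f (op (r + s) • m) = f (op r • m) + f (op s • m)
    rw [op_add, add_smul, map_add]
  zero_smul f := ext fun m => by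
    show f (op (0 : R) • m) = 0
    rw [op_zero, zero_smul, map_zero]

end Character

section Defs

variable (A : Type u) [Ring A]

/-- A pure embedding: an injective linear map such that every finite system of
linear equations with constants in `L` solvable in `M` is solvable in `L`. -/
def IsPureEmbedding {L M : Type u} [AddCommGroup L] [AddCommGroup M]
    [Module A L] [Module A M] (i : L →ₗ[A] M) : Prop :=
  Function.Injective i ∧
    ∀ (m n : ℕ) (r : Matrix (Fin m) (Fin n) A) (l : Fin m → L),
      (∃ x : Fin n → M, ∀ j, (∑ k, r j k • x k) = i (l j)) →
      ∃ y : Fin n → L, ∀ j, (∑ k, r j k • y k) = l j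

/-- A module is pure-injective if every pure embedding out of it splits. -/
def IsPureInjective (N : Type u) [AddCommGroup N] [Module A N] : Prop :=
  ∀ (M : Type u) [AddCommGroup M] [Module A M] (i : N →ₗ[A] M),
    IsPureEmbedding A i → ∃ π : M →ₗ[A] N, π.comp i = LinearMap.id

/-- `N` is (isomorphic to) a direct summand of `N'`. -/
def IsDirectSummand (N N' : Type u) [AddCommGroup N] [AddCommGroup N']
    [Module A N] [Module A N'] : Prop :=
  ∃ (i : N →ₗ[A] N') (π : N' →ₗ[A] N), π.comp i = LinearMap.id

/-- A module is indecomposable if it is nonzero and is not the internal direct sum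
of two nonzero submodules. -/
def IsIndecomposable (N : Type u) [AddCommGroup N] [Module A N] : Prop :=
  (∃ x : N, x ≠ 0) ∧ ∀ U V : Submodule A N, U ≠ ⊥ → V ≠ ⊥ → ¬ IsCompl U V

/-- An injective module: every linear map from a submodule of a module `B` into `E`
extends to `B`. -/
def IsInjectiveModule (E : Type u) [AddCommGroup E] [Module A E] : Prop :=
  ∀ (B : Type u) [AddCommGroup B] [Module A B] (L : Submodule A B) (g : L →ₗ[A] E),
    ∃ h : B →ₗ[A] E, ∀ x : L, h x = g x

/-- A cogenerator: points of any module are separated by maps into `E`. -/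
def IsCogenerator (E : Type u) [AddCommGroup E] [Module A E] : Prop :=
  ∀ (X : Type u) [AddCommGroup X] [Module A X] (x : X), x ≠ 0 →
    ∃ g : X →ₗ[A] E, g x ≠ 0

/-- A class of modules is closed under (arbitrary) direct products. -/
def ProdClosed (C : ModuleCat.{u} A → Prop) : Prop :=
  ∀ (ι : Type u) (f : ι → ModuleCat.{u} A), (∀ i, C (f i)) →
    C (ModuleCat.of A (∀ i, (f i : Type u)))

/-- A class of modules is closed under modules purely embedding into its members. -/
def PureSubClosed (C : ModuleCat.{u} A → Prop) : Prop :=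
  ∀ (N M : ModuleCat.{u} A) (i : N →ₗ[A] M), IsPureEmbedding A i → C M → C N

/-- A class of modules is closed under colimits of directed systems. -/
def DirLimClosed (C : ModuleCat.{u} A → Prop) : Prop :=
  ∀ (ι : Type u) [Preorder ι] [IsDirected ι (· ≤ ·)] [Nonempty ι] [DecidableEq ι]
    (G : ι → Type u) [∀ i, AddCommGroup (G i)] [∀ i, Module A (G i)]
    (f : ∀ i j, i ≤ j → G i →ₗ[A] G j) [DirectedSystem G (fun i j h => f i j h)],
    (∀ i, C (ModuleCat.of A (G i))) → C (ModuleCat.of A (Module.DirectLimit G f))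

/-- A definable subcategory: a class of modules (closed under isomorphism) which is closed
under direct products, colimits of directed systems, and pure submodules. -/
def IsDefinable (C : ModuleCat.{u} A → Prop) : Prop :=
  ProdClosed A C ∧ DirLimClosed A C ∧ PureSubClosed A C

end Defs


/-- The class of left `R`-modules whose character module lies in `P`. -/
def Sclass {R : Type u} [Ring R] (P : ModuleCat.{u} Rᵐᵒᵖ → Prop) :
    ModuleCat.{u} R → Prop :=
  fun M => P (ModuleCat.of Rᵐᵒᵖ (Character (M : Type u)))

/-- The closure of `P` under pure submodules. -/
def Pplus {R : Type u} [Ring R] (P : ModuleCat.{u} Rᵐᵒᵖ → Prop) :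
    ModuleCat.{u} Rᵐᵒᵖ → Prop :=
  fun N => ∃ N' : ModuleCat.{u} Rᵐᵒᵖ, P N' ∧
    ∃ i : (N : Type u) →ₗ[Rᵐᵒᵖ] (N' : Type u), IsPureEmbedding Rᵐᵒᵖ i

/-- The class `Prod(S*)`: direct summands of products of character modules of members
of the class `S` dual to `P`. -/
def ProdSStar {R : Type u} [Ring R] (P : ModuleCat.{u} Rᵐᵒᵖ → Prop) :
    ModuleCat.{u} Rᵐᵒᵖ → Prop :=
  fun N => ∃ (ι : Type u) (A : ι → ModuleCat.{u} R),
    (∀ i, Sclass P (A i)) ∧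
    IsDirectSummand Rᵐᵒᵖ (N : Type u) (∀ i, Character (A i : Type u))

namespace Character

section Group

variable {M N : Type u} [AddCommGroup M] [AddCommGroup N]

/-- View an additive map to `ℚ/ℤ` as an element of the character group. -/
def ofHom (f : M →+ RatCircle) : Character M := f

@[simp] lemma ofHom_apply (f : M →+ RatCircle) (m : M) : ofHom f m = f m := rfl

@[simp] lemma add_apply (f g : Character M) (m : M) : (f + g) m = f m + g m := rfl

@[simp] lemma sub_apply (f g : Character M) (m : M) : (f - g) m = f m - g m := rfl

@[simp] lemma zero_apply (m : M) : (0 : Character M) m = 0 := rfl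

/-- Evaluation at `m` as an additive map. -/
def evalHom (m : M) : Character M →+ RatCircle where
  toFun f := f m
  map_zero' := rfl
  map_add' _ _ := rfl

@[simp] lemma evalHom_apply (m : M) (f : Character M) : evalHom m f = f m := rfl

lemma sum_apply {ι : Type*} (s : Finset ι) (f : ι → Character M) (m : M) :
    (∑ i ∈ s, f i) m = ∑ i ∈ s, f i m :=
  map_sum (evalHom m) f s

/-- Restriction of characters along an additive map. -/
def precomp (φ : M →+ N) : Character N →+ Character M where
  toFun f := ofHom ((f : N →+ RatCircle).comp φ)
  map_zero' := rfl
  map_add' _ _ := rfl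

@[simp] lemma precomp_apply (φ : M →+ N) (f : Character N) (m : M) : precomp φ f m = f (φ m) := rfl

end Group

lemma exists_extension {V W : Type*} [AddCommGroup V] [AddCommGroup W]
    (f : V →+ W) (ψ : V →+ RatCircle) (h : ∀ v, f v = 0 → ψ v = 0) :
    ∃ θ : W →+ RatCircle, ∀ v, θ (f v) = ψ v := by
  let F : (V ⧸ f.ker) →+ W := QuotientAddGroup.kerLift f
  let Ψ : (V ⧸ f.ker) →+ RatCircle := QuotientAddGroup.lift f.ker ψ (fun v hv => h v hv)
  obtain ⟨θ, hθ⟩ := CharacterModule.dual_surjective_of_injective F.toIntLinearMap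
    (QuotientAddGroup.kerLift_injective f) (Ψ : CharacterModule (V ⧸ f.ker))
  refine ⟨θ, fun v => ?_⟩
  exact DFunLike.congr_fun hθ (QuotientAddGroup.mk v : V ⧸ f.ker)

lemma exists_separating {V : Type*} [AddCommGroup V] (H : AddSubgroup V) {v : V} (hv : v ∉ H) :
    ∃ χ : V →+ RatCircle, (∀ h ∈ H, χ h = 0) ∧ χ v ≠ 0 := by
  have hne : (QuotientAddGroup.mk v : V ⧸ H) ≠ 0 := by
    rwa [Ne, QuotientAddGroup.eq_zero_iff]
  obtain ⟨c, hc⟩ : ∃ c : (V ⧸ H) →+ RatCircle, c (QuotientAddGroup.mk v) ≠ 0 :=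
    CharacterModule.exists_character_apply_ne_zero_of_ne_zero hne
  refine ⟨c.comp (QuotientAddGroup.mk' H), fun h hh => ?_, hc⟩
  have : (QuotientAddGroup.mk' H) h = 0 := (QuotientAddGroup.eq_zero_iff h).2 hh
  rw [AddMonoidHom.comp_apply, this, map_zero]

lemma hom_apply_eq_sum {ι : Type*} [Fintype ι] [DecidableEq ι] {V : ι → Type*}
    [∀ i, AddCommGroup (V i)] (χ : (∀ i, V i) →+ RatCircle) (v : ∀ i, V i) :
    χ v = ∑ i, χ (Pi.single i (v i)) := by
  conv_lhs => rw [← Finset.univ_sum_single v]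
  rw [map_sum]

end Character

open Character hiding add_apply sub_apply zero_apply sum_apply

section Pure

variable {A : Type u} [Ring A]
variable {L M N : Type u} [AddCommGroup L] [AddCommGroup M] [AddCommGroup N]
variable [Module A L] [Module A M] [Module A N]

lemma IsPureEmbedding.of_solvable (i : L →ₗ[A] M)
    (h : ∀ (m n : ℕ) (r : Matrix (Fin m) (Fin n) A) (l : Fin m → L),
      (∃ x : Fin n → M, ∀ j, (∑ k, r j k • x k) = i (l j)) →
      ∃ y : Fin n → L, ∀ j, (∑ k, r j k • y k) = l j) : IsPureEmbedding A i := by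
  refine ⟨(injective_iff_map_eq_zero i).2 fun a ha => ?_, h⟩
  obtain ⟨y, hy⟩ := h 1 0 0 (fun _ => a) ⟨finZeroElim, fun _ => by simp [ha]⟩
  simpa using (hy 0).symm

lemma IsPureEmbedding.solvable_fintype {i : L →ₗ[A] M} (hi : IsPureEmbedding A i)
    {I J : Type*} [Fintype I] [Fintype J] (r : I → J → A) (l : I → L) (x : J → M)
    (hx : ∀ j, (∑ k, r j k • x k) = i (l j)) :
    ∃ y : J → L, ∀ j, (∑ k, r j k • y k) = l j := by
  let eI := Fintype.equivFin I
  let eJ := Fintype.equivFin J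
  obtain ⟨y, hy⟩ := hi.2 _ _ (fun a b => r (eI.symm a) (eJ.symm b)) (fun a => l (eI.symm a))
    ⟨fun b => x (eJ.symm b), fun a => by
      rw [← hx]; exact eJ.symm.sum_comp (fun k => r (eI.symm a) k • x k)⟩
  refine ⟨fun k => y (eJ k), fun j => ?_⟩
  have := hy (eI j)
  simp only [Equiv.symm_apply_apply] at this
  rw [← this, ← eJ.sum_comp]
  simp

lemma IsPureEmbedding.id : IsPureEmbedding A (LinearMap.id : L →ₗ[A] L) :=
  .of_solvable _ fun _ _ _ _ h => h

lemma IsPureEmbedding.comp {g : M →ₗ[A] N} {f : L →ₗ[A] M} (hg : IsPureEmbedding A g)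
    (hf : IsPureEmbedding A f) : IsPureEmbedding A (g.comp f) :=
  .of_solvable _ fun m n r l h => hf.2 m n r l (hg.2 m n r (fun j => f (l j)) h)

lemma IsDirectSummand.isPureEmbedding {i : L →ₗ[A] M} {π : M →ₗ[A] L}
    (h : π.comp i = LinearMap.id) : IsPureEmbedding A i := by
  refine .of_solvable _ fun m n r l ⟨x, hx⟩ => ⟨fun k => π (x k), fun j => ?_⟩
  have := congrArg π (hx j)
  rw [map_sum] at this
  simpa only [map_smul, ← LinearMap.comp_apply, h, LinearMap.id_apply] using this

lemma IsPureEmbedding.pi {ι : Type u} {X Y : ι → Type u} [∀ i, AddCommGroup (X i)]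
    [∀ i, AddCommGroup (Y i)] [∀ i, Module A (X i)] [∀ i, Module A (Y i)]
    (f : ∀ i, X i →ₗ[A] Y i) (hf : ∀ i, IsPureEmbedding A (f i)) :
    IsPureEmbedding A (LinearMap.pi fun i => (f i).comp (LinearMap.proj i)) := by
  refine .of_solvable _ fun m n r l ⟨x, hx⟩ => ?_
  have h : ∀ i, ∃ y : Fin n → X i, ∀ j, (∑ k, r j k • y k) = l j i := fun i =>
    (hf i).2 m n r (fun j => l j i) ⟨fun k => x k i, fun j => by
      simpa using congrFun (hx j) i⟩
  choose y hy using h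
  exact ⟨fun k i => y i k, fun j => funext fun i => by simpa using hy i j⟩

lemma IsPureEmbedding.directSum_coe {ι : Type u} [DecidableEq ι] {X : ι → Type u}
    [∀ i, AddCommGroup (X i)] [∀ i, Module A (X i)] :
    IsPureEmbedding A (DFinsupp.coeFnLinearMap A : (⨁ i, X i) →ₗ[A] ∀ i, X i) := by
  classical
  refine .of_solvable _ fun m n r l ⟨x, hx⟩ => ?_
  let s : Finset ι := Finset.univ.biUnion fun j => DFinsupp.support (l j)
  refine ⟨fun k => DFinsupp.mk s fun i => x k i, fun j => ?_⟩
  refine DFinsupp.ext fun i => ?_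
  have hi : (∑ k, r j k • x k i) = l j i := by simpa using congrFun (hx j) i
  rw [← hi]
  have e : (∑ k, r j k • (DFinsupp.mk s fun i => x k i : ⨁ i, X i)) i
      = ∑ k, r j k • (DFinsupp.mk s (fun i => x k i) : ⨁ i, X i) i := by
    rw [DFinsupp.finsetSum_apply]; rfl
  rw [e]
  by_cases his : i ∈ s
  · simp [DFinsupp.mk_apply, his]
  · have : l j i = 0 := by
      by_contra h
      exact his (Finset.mem_biUnion.2 ⟨j, Finset.mem_univ _, DFinsupp.mem_support_iff.2 h⟩)
    rw [hi, this]
    simp [DFinsupp.mk_apply, his]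

end Pure

section Dual

variable {A B : Type u} [Ring A] [Ring B]

/-- The `B`-module structure on the characters of the `A`-module `M` is dual, along `σ : B → A`,
to the action of `A` on `M`. -/
def IsDualAction (σ : B → A) (M : Type u) [AddCommGroup M] [Module A M]
    [Module B (Character M)] : Prop :=
  ∀ (b : B) (f : Character M) (m : M), (b • f) m = f (σ b • m)

variable {σ : B → A} {τ : A → B}
variable {M N X : Type u} [AddCommGroup M] [AddCommGroup N] [AddCommGroup X]
variable [Module A M] [Module A N] [Module A X]

section

variable [Module B (Character M)]

/-- A finite linear system over a character module is solvable exactly when its constants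
satisfy every relation forced by the left-hand sides. -/
lemma IsDualAction.solvable_iff (hM : IsDualAction σ M) {m n : ℕ} (r : Matrix (Fin m) (Fin n) B)
    (l : Fin m → Character M) :
    (∃ y : Fin n → Character M, ∀ j, (∑ k, r j k • y k) = l j) ↔
      ∀ z : Fin m → M, (∀ k, ∑ j, σ (r j k) • z j = 0) → ∑ j, l j (z j) = 0 := by
  constructor
  · rintro ⟨y, hy⟩ z hz
    simp only [← hy, Character.sum_apply, hM _ _ _]
    rw [Finset.sum_comm]
    refine Finset.sum_eq_zero fun k _ => ?_
    rw [← map_sum, hz k, map_zero]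
  · intro h
    let f : (Fin m → M) →+ (Fin n → M) :=
      { toFun := fun z k => ∑ j, σ (r j k) • z j
        map_zero' := by ext; simp
        map_add' := fun a b => by ext; simp [Finset.sum_add_distrib] }
    let ψ : (Fin m → M) →+ RatCircle :=
      { toFun := fun z => ∑ j, l j (z j)
        map_zero' := by simp
        map_add' := fun a b => by simp [Finset.sum_add_distrib] }
    obtain ⟨θ, hθ⟩ := exists_extension f ψ fun z hz => h z fun k => congrFun hz k
    refine ⟨fun k => ofHom (θ.comp (AddMonoidHom.single (fun _ => M) k)), fun j => ?_⟩
    refine Character.ext fun z => ?_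
    have h1 : ψ (Pi.single j z) = l j z := by
      show ∑ j', l j' ((Pi.single j z : Fin m → M) j') = _
      rw [Finset.sum_eq_single j]
      · simp
      · intro b _ hb; rw [Pi.single_eq_of_ne hb, map_zero]
      · simp
    rw [Character.sum_apply, ← h1, ← hθ, hom_apply_eq_sum θ]
    refine Finset.sum_congr rfl fun k _ => ?_
    rw [hM _ _ _]
    show θ (Pi.single k _) = θ (Pi.single k (∑ j', σ (r j' k) • (Pi.single j z : Fin m → M) j'))
    rw [Finset.sum_eq_single j]
    · simp
    · intro b _ hb; rw [Pi.single_eq_of_ne hb, smul_zero]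
    · simp

end

section Extension

variable (C : Type u) [AddCommGroup C] [Module A (Character C)]

/-- The formal relations between elements of `C` that are respected by all of `Character C`. -/
abbrev CharRel : Type u :=
  {ρ : C →₀ A // ∀ f : Character C, (ρ.sum fun c a => (a • f) c) = 0}

/-- The presentation map whose cokernel plays the role of the tensor product of `X` and `C`. -/
def charRelMap (X : Type u) [AddCommGroup X] [Module A X] :
    (CharRel (A := A) C →₀ X) →+ (C →₀ X) :=
  Finsupp.liftAddHom fun ρ =>
    { toFun := fun x => ρ.1.mapRange (fun a => a • x) (zero_smul A x)
      map_zero' := by ext; simp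
      map_add' := fun x y => by ext; simp [smul_add] }

lemma charRelMap_apply (s : CharRel (A := A) C →₀ X) (c : C) :
    charRelMap C X s c = ∑ ρ ∈ s.support, ρ.1 c • s ρ := by
  simp [charRelMap, Finsupp.sum, Finsupp.finsetSum_apply]

lemma charRelMap_single (ρ : CharRel (A := A) C) (x : X) :
    charRelMap C X (Finsupp.single ρ x) = ρ.1.mapRange (fun a => a • x) (zero_smul A x) :=
  Finsupp.liftAddHom_apply_single _ _ _

lemma charRel_sum (ρ : CharRel (A := A) C) (D : Finset C) (hD : ρ.1.support ⊆ D)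
    (f : Character C) : ∑ c ∈ D, (ρ.1 c • f) c = 0 := by
  refine Eq.trans (Finset.sum_subset hD fun c _ hc => ?_).symm (ρ.2 f)
  rw [Finsupp.notMem_support_iff.1 hc, zero_smul, Character.zero_apply]

variable {C}

/-- Linear maps into a character module extend along pure embeddings. -/
lemma IsPureEmbedding.exists_extension {i : N →ₗ[A] X} (hi : IsPureEmbedding A i)
    (hC : ∀ (a : A) (c : C), ∃ c' : C, ∀ f : Character C, (a • f) c = f c')
    (g : N →ₗ[A] Character C) : ∃ h : X →ₗ[A] Character C, h.comp i = g := by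
  classical
  let q : (C →₀ X) →+ (C →₀ X) ⧸ (charRelMap (A := A) C X).range := QuotientAddGroup.mk' _
  let F : (C →₀ N) →+ (C →₀ X) := Finsupp.mapRange.addMonoidHom i.toAddMonoidHom
  let ψ : (C →₀ N) →+ RatCircle :=
    Finsupp.liftAddHom fun c => (evalHom c).comp g.toAddMonoidHom
  have key : ∀ w, (q.comp F) w = 0 → ψ w = 0 := by
    intro w hw
    obtain ⟨s, hs⟩ : F w ∈ (charRelMap (A := A) C X).range := (QuotientAddGroup.eq_zero_iff _).1 hw
    let D : Finset C := w.support ∪ s.support.biUnion fun ρ => ρ.1.support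
    obtain ⟨y, hy⟩ := hi.solvable_fintype (I := D) (J := s.support) (fun c ρ => ρ.1.1 c.1)
      (fun c => w c.1) (fun ρ => s ρ.1) fun c => by
        have := DFunLike.congr_fun hs c.1
        rw [charRelMap_apply] at this
        rw [Finset.sum_coe_sort s.support (fun ρ => ρ.1 c.1 • s ρ), this]
        rfl
    have e : ψ w = ∑ c ∈ D, g (w c) c := by
      have : ψ w = w.sum fun c n => g n c := rfl
      rw [this, Finsupp.sum]
      refine Finset.sum_subset Finset.subset_union_left fun c _ hc => ?_
      rw [Finsupp.notMem_support_iff.1 hc, map_zero, Character.zero_apply]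
    rw [e, ← Finset.sum_coe_sort]
    have e2 : ∀ c : D, g (w c.1) c.1 = ∑ ρ : s.support, (ρ.1.1 c.1 • g (y ρ)) c.1 := fun c => by
      rw [← hy c, map_sum, Character.sum_apply]
      simp only [map_smul]
    simp only [e2]
    rw [Finset.sum_comm]
    refine Finset.sum_eq_zero fun ρ _ => ?_
    rw [Finset.sum_coe_sort D (fun c => (ρ.1.1 c • g (y ρ)) c)]
    refine charRel_sum C ρ.1 D ?_ _
    exact (Finset.subset_biUnion_of_mem (fun ρ : CharRel (A := A) C => ρ.1.support) ρ.2).trans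
      Finset.subset_union_right
  obtain ⟨θ, hθ⟩ := Character.exists_extension (q.comp F) ψ key
  have hrel : ∀ (ρ : CharRel (A := A) C) (x : X),
      θ (q (ρ.1.mapRange (fun a => a • x) (zero_smul A x))) = 0 := fun ρ x => by
    have : q (ρ.1.mapRange (fun a => a • x) (zero_smul A x)) = 0 :=
      (QuotientAddGroup.eq_zero_iff _).2 ⟨_, charRelMap_single C ρ x⟩
    rw [this, map_zero]
  let h : X →ₗ[A] Character C :=
    { toFun := fun x => ofHom
        { toFun := fun c => θ (q (Finsupp.single c x))
          map_zero' := by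
            have := hrel ⟨Finsupp.single 0 1, fun f => by
              rw [Finsupp.sum_single_index] <;> simp⟩ x
            simpa using this
          map_add' := fun c c' => by
            have := hrel ⟨Finsupp.single (c + c') 1 - Finsupp.single c 1 - Finsupp.single c' 1,
              fun f => by
                rw [Finsupp.sum_sub_index, Finsupp.sum_sub_index, Finsupp.sum_single_index,
                  Finsupp.sum_single_index, Finsupp.sum_single_index] <;>
                simp [sub_smul, Character.sub_apply]⟩ x
            have e : Finsupp.mapRange (fun a : A => a • x) (zero_smul A x)
                (Finsupp.single (c + c') 1 - Finsupp.single c 1 - Finsupp.single c' 1)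
                = Finsupp.single (c + c') x - Finsupp.single c x - Finsupp.single c' x := by
              rw [Finsupp.mapRange_sub, Finsupp.mapRange_sub] <;> simp [sub_smul]
            rw [e, map_sub, map_sub, map_sub, map_sub, sub_sub, sub_eq_zero] at this
            exact this }
      map_add' := fun x y => by
        ext c
        simp
      map_smul' := fun a x => by
        ext c
        obtain ⟨c', hc'⟩ := hC a c
        rw [RingHom.id_apply, hc']
        have := hrel ⟨Finsupp.single c a - Finsupp.single c' 1, fun f => by
          rw [Finsupp.sum_sub_index, Finsupp.sum_single_index, Finsupp.sum_single_index] <;>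
          simp [hc', sub_smul, Character.sub_apply]⟩ x
        have e : Finsupp.mapRange (fun a : A => a • x) (zero_smul A x)
            (Finsupp.single c a - Finsupp.single c' 1)
            = Finsupp.single c (a • x) - Finsupp.single c' x := by
          rw [Finsupp.mapRange_sub] <;> simp [sub_smul]
        rw [e, map_sub, map_sub, sub_eq_zero] at this
        exact this }
  refine ⟨h, LinearMap.ext fun n => Character.ext fun c => ?_⟩
  have h1 := hθ (Finsupp.single c n)
  have h2 : ψ (Finsupp.single c n) = g n c := by simp [ψ]
  have h3 : F (Finsupp.single c n) = Finsupp.single c (i n) := by simp [F]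
  rw [h2, AddMonoidHom.comp_apply, h3] at h1
  exact h1

end Extension

end Dual

section DoubleDual

variable {A B : Type u} [Ring A] [Ring B] {σ : B → A} {τ : A → B}
variable {M N L : Type u} [AddCommGroup M] [AddCommGroup N] [AddCommGroup L]
variable [Module A M] [Module A L] [Module B N]
variable [Module B (Character M)] [Module B (Character L)]

lemma IsDualAction.exists_smul_apply_eq (hM : IsDualAction σ M) (b : B) (m : M) :
    ∃ m' : M, ∀ f : Character M, (b • f) m = f m' :=
  ⟨σ b • m, fun f => hM b f m⟩

lemma IsDualAction.isPureInjective_of_isDirectSummand (hM : IsDualAction σ M)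
    (h : IsDirectSummand B N (Character M)) : IsPureInjective B N := by
  obtain ⟨i, π, hπ⟩ := h
  intro X _ _ j hj
  obtain ⟨g, hg⟩ := hj.exists_extension hM.exists_smul_apply_eq i
  exact ⟨π.comp g, by rw [LinearMap.comp_assoc, hg, hπ]⟩

lemma IsDualAction.isPureInjective (hM : IsDualAction σ M) : IsPureInjective B (Character M) :=
  hM.isPureInjective_of_isDirectSummand ⟨LinearMap.id, LinearMap.id, rfl⟩

/-- Every module embeds purely into its double character module by evaluation. -/
lemma IsDualAction.exists_pure_eval [Module A (Character (Character M))]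
    (hM : IsDualAction σ M) (hMM : IsDualAction τ (Character M)) (hστ : ∀ a, σ (τ a) = a) :
    ∃ e : M →ₗ[A] Character (Character M), (∀ m f, e m f = f m) ∧ IsPureEmbedding A e := by
  let e : M →ₗ[A] Character (Character M) :=
    { toFun := fun m => ofHom (evalHom m)
      map_add' := fun m m' => Character.ext fun f => map_add f m m'
      map_smul' := fun a m => Character.ext fun f => by
        rw [RingHom.id_apply, hMM a _ f]
        show f (a • m) = (τ a • f) m
        rw [hM _ _ _, hστ] }
  refine ⟨e, fun _ _ => rfl, .of_solvable _ fun m n r l hl => ?_⟩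
  by_contra hns
  let F : (Fin n → M) →+ (Fin m → M) :=
    { toFun := fun y j => ∑ k, r j k • y k
      map_zero' := by ext; simp
      map_add' := fun a b => by ext; simp [Finset.sum_add_distrib] }
  have hlF : l ∉ F.range := fun ⟨y, hy⟩ => hns ⟨y, fun j => congrFun hy j⟩
  obtain ⟨χ, hχ, hχl⟩ := exists_separating F.range hlF
  apply hχl
  rw [hom_apply_eq_sum χ]
  refine (hMM.solvable_iff r fun j => e (l j)).1 hl
    (fun j => ofHom (χ.comp (AddMonoidHom.single (fun _ => M) j))) fun k => ?_
  refine Character.ext fun x => ?_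
  have h0 : χ (F (Pi.single k x)) = 0 := hχ _ ⟨_, rfl⟩
  rw [hom_apply_eq_sum χ] at h0
  rw [Character.sum_apply, Character.zero_apply, ← h0]
  refine Finset.sum_congr rfl fun j _ => ?_
  rw [hM _ _ _, hστ]
  show χ (Pi.single j _) = χ (Pi.single j (∑ k', r j k' • (Pi.single k x : Fin n → M) k'))
  rw [Finset.sum_eq_single k]
  · simp
  · intro b _ hb; rw [Pi.single_eq_of_ne hb, smul_zero]
  · simp

/-- The dual of a pure embedding is a split epimorphism. -/
lemma IsPureEmbedding.character_isDirectSummand [Module A (Character (Character L))]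
    {i : L →ₗ[A] M} (hi : IsPureEmbedding A i) (hL : IsDualAction σ L) (hM : IsDualAction σ M)
    (hLL : IsDualAction τ (Character L)) (hστ : ∀ a, σ (τ a) = a) (hτσ : ∀ b, τ (σ b) = b) :
    IsDirectSummand B (Character L) (Character M) := by
  obtain ⟨e, he, -⟩ := hL.exists_pure_eval hLL hστ
  obtain ⟨h, hh⟩ := hi.exists_extension hLL.exists_smul_apply_eq e
  refine ⟨⟨⟨fun f => ofHom ((evalHom f).comp h.toAddMonoidHom), fun f g => ?_⟩, fun b f => ?_⟩,
    ⟨⟨precomp i.toAddMonoidHom, map_add _⟩, fun b f => ?_⟩, ?_⟩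
  · exact Character.ext fun m => map_add (h m) f g
  · refine Character.ext fun m => ?_
    rw [RingHom.id_apply, hM _ _ _]
    show h m (b • f) = h (σ b • m) f
    rw [h.map_smul, hLL _ _ _, hτσ]
  · refine Character.ext fun x => ?_
    show (b • f) (i x) = (b • precomp i.toAddMonoidHom f) x
    rw [hM _ _ _, hL _ _ _]
    show _ = f (i (σ b • x))
    rw [i.map_smul]
  · refine LinearMap.ext fun f => Character.ext fun x => ?_
    show h (i x) f = f x
    rw [← LinearMap.comp_apply, hh, he]

end DoubleDual

section Colimits

variable {A B : Type u} [Ring A] [Ring B] {σ : B → A} {τ : A → B}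
variable {ι : Type u} [DecidableEq ι] {G : ι → Type u} [∀ i, AddCommGroup (G i)]
variable [∀ i, Module A (G i)] [∀ i, Module B (Character (G i))]

lemma character_directLimit_isDirectSummand [Preorder ι] [IsDirected ι (· ≤ ·)] [Nonempty ι]
    (f : ∀ i j, i ≤ j → G i →ₗ[A] G j) [DirectedSystem G (fun i j h => f i j h)]
    [Module B (Character (Module.DirectLimit G f))]
    (hG : ∀ i, IsDualAction σ (G i)) (hlim : IsDualAction σ (Module.DirectLimit G f)) :
    IsDirectSummand B (Character (Module.DirectLimit G f)) (∀ i, Character (G i)) := by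
  let φ : ∀ i, G i →ₗ[A] Module.DirectLimit G f := Module.DirectLimit.of A ι G f
  let Φ : Character (Module.DirectLimit G f) →ₗ[B] ∀ i, Character (G i) :=
    { toFun := fun g i => precomp (φ i).toAddMonoidHom g
      map_add' := fun g g' => rfl
      map_smul' := fun b g => funext fun i => Character.ext fun x => by
        show (b • g) (φ i x) = (b • precomp (φ i).toAddMonoidHom g) x
        rw [hlim _ _ _, hG i _ _ _]
        show _ = g (φ i (σ b • x))
        rw [(φ i).map_smul] }
  have hΦ : IsPureEmbedding B Φ := by
    refine .of_solvable _ fun m n r l ⟨x, hx⟩ => ?_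
    refine (hlim.solvable_iff r l).2 fun z hz => ?_
    obtain ⟨i, w, hw⟩ : ∃ i, ∃ w : Fin m → G i, ∀ j, φ i (w j) = z j := by
      choose s w hw using fun j => Module.DirectLimit.exists_of (z j)
      obtain ⟨i, hi⟩ := Finite.exists_le s
      exact ⟨i, fun j => f (s j) i (hi j) (w j), fun j => by
        rw [← hw j]; exact Module.DirectLimit.of_f⟩
    have h1 : ∀ k, ∃ i', ∃ h : i ≤ i', f i i' h (∑ j, σ (r j k) • w j) = 0 := fun k => by
      refine Module.DirectLimit.of.zero_exact (R := A) (G := G) (f := f) ?_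
      show φ i _ = 0
      rw [map_sum, ← hz k]
      exact Finset.sum_congr rfl fun j _ => by rw [map_smul, hw]
    choose s hs hs0 using h1
    obtain ⟨i'', hi''⟩ := Finite.exists_le s
    obtain ⟨i', hii, hi'⟩ := exists_ge_ge i i''
    have h2 := ((hG i').solvable_iff r fun j => Φ (l j) i').1
      ⟨fun k => x k i', fun j => by simpa using congrFun (hx j) i'⟩
      (fun j => f i i' hii (w j)) fun k => by
        have := congrArg (f (s k) i' ((hi'' k).trans hi')) (hs0 k)
        rw [DirectedSystem.map_map' (f := f), map_zero, map_sum] at this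
        simpa only [map_smul] using this
    rw [← h2]
    refine Finset.sum_congr rfl fun j _ => ?_
    show l j (z j) = l j (φ i' (f i i' hii (w j)))
    rw [← hw j]
    exact congrArg (l j) Module.DirectLimit.of_f.symm
  obtain ⟨π, hπ⟩ := hlim.isPureInjective _ Φ hΦ
  exact ⟨Φ, π, hπ⟩

/-- The character module of a direct sum is the product of the character modules. -/
def characterDirectSumEquiv [Module B (Character (⨁ i, G i))]
    (hG : ∀ i, IsDualAction σ (G i)) (hsum : IsDualAction σ (⨁ i, G i)) :
    Character (⨁ i, G i) ≃ₗ[B] ∀ i, Character (G i) where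
  toFun f i := precomp (DirectSum.of G i) f
  map_add' _ _ := rfl
  map_smul' b f := funext fun i => Character.ext fun x => by
    show (b • f) (DirectSum.of G i x) = (b • precomp (DirectSum.of G i) f) x
    rw [hsum _ _ _, hG i _ _ _]
    show _ = f (DirectSum.of G i (σ b • x))
    exact congrArg f (DFinsupp.single_smul _ _).symm
  invFun g := ofHom (DirectSum.toAddMonoid fun i => (g i : G i →+ RatCircle))
  left_inv f := Character.ext fun x => by
    show DirectSum.toAddMonoid (fun i => (precomp (DirectSum.of G i) f : G i →+ RatCircle)) x = f x
    have : DirectSum.toAddMonoid (fun i => (precomp (DirectSum.of G i) f : G i →+ RatCircle))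
        = (f : (⨁ i, G i) →+ RatCircle) := DirectSum.addHom_ext fun i y =>
      DirectSum.toAddMonoid_of _ i y
    rw [this]; rfl
  right_inv g := funext fun i => Character.ext fun x => by
    show DirectSum.toAddMonoid (fun i => (g i : G i →+ RatCircle)) (DirectSum.of G i x) = g i x
    exact DirectSum.toAddMonoid_of _ i x

lemma exists_pure_pi_character_directSum
    [Module A (Character (⨁ i, Character (G i)))] [∀ i, Module A (Character (Character (G i)))]
    (hG : ∀ i, IsDualAction σ (G i)) (hGG : ∀ i, IsDualAction τ (Character (G i)))
    (hsum : IsDualAction τ (⨁ i, Character (G i))) (hστ : ∀ a, σ (τ a) = a) :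
    ∃ j : (∀ i, G i) →ₗ[A] Character (⨁ i, Character (G i)), IsPureEmbedding A j := by
  choose e _ hp using fun i => (hG i).exists_pure_eval (hGG i) hστ
  let E := characterDirectSumEquiv hGG hsum
  refine ⟨E.symm.toLinearMap.comp (LinearMap.pi fun i => (e i).comp (LinearMap.proj i)),
    IsPureEmbedding.comp ?_ (IsPureEmbedding.pi e hp)⟩
  exact IsDirectSummand.isPureEmbedding (π := E.toLinearMap) (by ext1 x; simp)

end Colimits

section Definable

variable {A B : Type u} [Ring A] [Ring B] {σ : B → A} {τ : A → B}

/-- A definable class containing `Y` contains every `X` whose finite linear relations, together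
with the failure of a finite linear system, can be realised in `Y`. -/
lemma IsDefinable.mem_of_finitely_realised {C : ModuleCat.{u} A → Prop} (hC : IsDefinable A C)
    {X Y : Type u} [AddCommGroup X] [AddCommGroup Y] [Module A X] [Module A Y]
    (hY : C (ModuleCat.of A Y))
    (hXY : ∀ (E : Finset {ρ : X →₀ A // (ρ.sum fun x a => a • x) = 0}) (m n : ℕ)
      (r : Matrix (Fin m) (Fin n) A) (l : Fin m → X),
      (¬ ∃ y : Fin n → X, ∀ j, (∑ k, r j k • y k) = l j) →
      ∃ g : X → Y, (∀ ρ ∈ E, (ρ.1.sum fun x a => a • g x) = 0) ∧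
        ¬ ∃ y : Fin n → Y, ∀ j, (∑ k, r j k • y k) = g (l j)) :
    C (ModuleCat.of A X) := by
  classical
  let T := {ρ : X →₀ A // (ρ.sum fun x a => a • x) = 0}
  let Ψ := {s : Σ m : ℕ, Σ n : ℕ, Matrix (Fin m) (Fin n) A × (Fin m → X) //
    ¬ ∃ y : Fin s.2.1 → X, ∀ j, (∑ k, s.2.2.1 j k • y k) = s.2.2.2 j}
  choose g hg hg' using fun (E : Finset T) (s : Ψ) => hXY E s.1.1 s.1.2.1 s.1.2.2.1 s.1.2.2.2 s.2
  let S : Finset T → Type u := fun E => ({E' : Finset T // E ≤ E'} × Ψ) → Y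
  let f : ∀ E E' : Finset T, E ≤ E' → S E →ₗ[A] S E' := fun E E' h =>
    LinearMap.funLeft A Y fun p => (⟨p.1.1, h.trans p.1.2⟩, p.2)
  have : DirectedSystem S (fun E E' h => f E E' h) := ⟨fun _ _ => rfl, fun _ _ _ _ _ _ => rfl⟩
  let D := Module.DirectLimit S f
  have hD : C (ModuleCat.of A D) :=
    hC.2.1 (Finset T) S f fun E => hC.1 _ (fun _ => ModuleCat.of A Y) fun _ => hY
  let φ : ∀ E, S E →ₗ[A] D := Module.DirectLimit.of A _ S f
  let s : ∀ E, X → S E := fun E x p => g p.1.1 p.2 x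
  have hrel : ∀ ρ : T, (ρ.1.sum fun x a => a • φ ∅ (s ∅ x)) = 0 := fun ρ => by
    have h1 : (ρ.1.sum fun x a => a • s {ρ} x) = 0 := funext fun p => by
      have := hg p.1.1 p.2 ρ (p.1.2 (Finset.mem_singleton_self ρ))
      rw [Pi.zero_apply, ← this, Finsupp.sum, Finsupp.sum, Finset.sum_apply]
      rfl
    have h2 : ∀ x, φ ∅ (s ∅ x) = φ {ρ} (s {ρ} x) := fun x =>
      (Module.DirectLimit.of_f (f := f) (hij := Finset.empty_subset {ρ}) (x := s ∅ x)).symm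
    have h3 := congrArg (φ {ρ}) h1
    rw [map_zero, Finsupp.sum, map_sum] at h3
    rw [Finsupp.sum, ← h3]
    exact Finset.sum_congr rfl fun x _ => by rw [h2, map_smul]
  let e : X →ₗ[A] D :=
    { toFun := fun x => φ ∅ (s ∅ x)
      map_add' := fun x y => by
        have := hrel ⟨Finsupp.single (x + y) 1 - Finsupp.single x 1 - Finsupp.single y 1, by
          rw [Finsupp.sum_sub_index, Finsupp.sum_sub_index, Finsupp.sum_single_index,
            Finsupp.sum_single_index, Finsupp.sum_single_index] <;> simp [sub_smul]⟩
        rw [Finsupp.sum_sub_index, Finsupp.sum_sub_index, Finsupp.sum_single_index,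
          Finsupp.sum_single_index, Finsupp.sum_single_index, one_smul, one_smul, one_smul,
          sub_sub, sub_eq_zero] at this <;> simp [sub_smul, this]
      map_smul' := fun a x => by
        have := hrel ⟨Finsupp.single (a • x) 1 - Finsupp.single x a, by
          rw [Finsupp.sum_sub_index, Finsupp.sum_single_index,
            Finsupp.sum_single_index] <;> simp [sub_smul]⟩
        rw [Finsupp.sum_sub_index, Finsupp.sum_single_index,
          Finsupp.sum_single_index, one_smul, sub_eq_zero] at this <;> simp [sub_smul, this] }
  refine hC.2.2 (ModuleCat.of A X) (ModuleCat.of A D) e (.of_solvable _ ?_) hD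
  rintro m n r l ⟨y, hy⟩
  by_contra hns
  choose t w hw using fun k => Module.DirectLimit.exists_of (y k)
  obtain ⟨E, hE⟩ := Finite.exists_le t
  let w' : Fin n → S E := fun k => f (t k) E (hE k) (w k)
  have hw' : ∀ k, φ E (w' k) = y k := fun k => by
    rw [← hw k]; exact Module.DirectLimit.of_f (hij := hE k)
  have h1 : ∀ j, ∃ E', ∃ h : E ≤ E', f E E' h ((∑ k, r j k • w' k) - s E (l j)) = 0 := fun j => by
    refine Module.DirectLimit.of.zero_exact (R := A) (G := S) (f := f) ?_
    show φ E _ = 0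
    have h2 : φ ∅ (s ∅ (l j)) = φ E (s E (l j)) :=
      (Module.DirectLimit.of_f (f := f) (hij := Finset.empty_subset E) (x := s ∅ (l j))).symm
    rw [map_sub, ← h2, sub_eq_zero]
    refine Eq.trans ?_ (hy j)
    rw [map_sum]
    exact Finset.sum_congr rfl fun k _ => by rw [map_smul, hw']
  choose E' hE' h0 using h1
  obtain ⟨E₁, hE₁⟩ := Finite.exists_le E'
  let E₂ := E ∪ E₁
  let ψ : Ψ := ⟨⟨m, n, r, l⟩, hns⟩
  refine hg' E₂ ψ ⟨fun k => w' k (⟨E₂, Finset.subset_union_left⟩, ψ), fun j => ?_⟩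
  have h3 := congrFun (h0 j) (⟨E₂, (hE₁ j).trans Finset.subset_union_right⟩, ψ)
  have h4 : (∑ k, r j k • w' k) (⟨E₂, Finset.subset_union_left⟩, ψ)
      - g E₂ ψ (l j) = 0 := h3
  rw [Finset.sum_apply, sub_eq_zero] at h4
  exact h4

/-- Definable classes are closed under double character modules. -/
lemma IsDefinable.character_character {C : ModuleCat.{u} A → Prop} (hC : IsDefinable A C)
    {M : Type u} [AddCommGroup M] [Module A M] [Module B (Character M)]
    [Module A (Character (Character M))] (hM : IsDualAction σ M)
    (hMM : IsDualAction τ (Character M)) (hστ : ∀ a, σ (τ a) = a)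
    (h : C (ModuleCat.of A M)) : C (ModuleCat.of A (Character (Character M))) := by
  classical
  refine hC.mem_of_finitely_realised h fun E m n r l hns => ?_
  by_contra! hcon
  refine hns ((hMM.solvable_iff r l).2 fun χ hχ => ?_)
  let F : (Character (Character M) → M) →+ (E → M) :=
    { toFun := fun g ρ => ρ.1.1.sum fun x a => a • g x
      map_zero' := by ext; simp
      map_add' := fun a b => by ext; simp }
  let Θ : (Character (Character M) → M) →+ RatCircle :=
    { toFun := fun g => ∑ j, χ j (g (l j))
      map_zero' := by simp
      map_add' := fun a b => by simp [Finset.sum_add_distrib] }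
  obtain ⟨θ, hθ⟩ := exists_extension F Θ fun g hg => by
    obtain ⟨y, hy⟩ := hcon g fun ρ hρ => congrFun hg ⟨ρ, hρ⟩
    show ∑ j, χ j (g (l j)) = 0
    simp only [← hy, map_sum]
    rw [Finset.sum_comm]
    refine Finset.sum_eq_zero fun k _ => ?_
    have := DFunLike.congr_fun (hχ k) (y k)
    rw [Character.sum_apply, Character.zero_apply] at this
    rw [← this]
    exact Finset.sum_congr rfl fun j _ => by rw [hM _ _ _, hστ]
  let θ' : E → Character M := fun ρ => ofHom (θ.comp (AddMonoidHom.single (fun _ => M) ρ))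
  have hcomp : ∀ x, (∑ j, if l j = x then χ j else 0) = ∑ ρ : E, τ (ρ.1.1 x) • θ' ρ := by
    intro x
    refine Character.ext fun z => ?_
    have h1 := hθ (Pi.single x z)
    rw [hom_apply_eq_sum θ] at h1
    rw [Character.sum_apply, Character.sum_apply]
    refine Eq.trans (Eq.trans ?_ h1.symm) ?_
    · refine Finset.sum_congr rfl fun j _ => ?_
      split_ifs with hj
      · rw [hj, Pi.single_eq_same]
      · rw [Pi.single_eq_of_ne hj, map_zero, Character.zero_apply]
    · refine Finset.sum_congr rfl fun ρ _ => ?_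
      rw [hM _ _ _, hστ]
      show θ (Pi.single ρ (ρ.1.1.sum fun x' a => a • (Pi.single x z : _ → M) x')) =
        θ (Pi.single ρ (ρ.1.1 x • z))
      congr 2
      rw [Finsupp.sum, Finset.sum_eq_single x]
      · rw [Pi.single_eq_same]
      · intro b _ hb; rw [Pi.single_eq_of_ne hb, smul_zero]
      · intro hx; rw [Finsupp.notMem_support_iff.1 hx, zero_smul]
  let D : Finset (Character (Character M)) :=
    Finset.univ.image l ∪ E.biUnion fun ρ => ρ.1.support
  have h1 : ∑ j, l j (χ j) = ∑ x ∈ D, x (∑ j, if l j = x then χ j else 0) := by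
    simp only [map_sum]
    rw [Finset.sum_comm]
    refine Finset.sum_congr rfl fun j _ => ?_
    rw [Finset.sum_eq_single (l j)]
    · rw [if_pos rfl]
    · intro b _ hb; rw [if_neg (Ne.symm hb), map_zero]
    · intro hj
      exact absurd (Finset.mem_union_left _ (Finset.mem_image_of_mem l (Finset.mem_univ j))) hj
  rw [h1]
  simp only [hcomp, map_sum]
  rw [Finset.sum_comm]
  refine Finset.sum_eq_zero fun ρ _ => ?_
  have h2 := DFunLike.congr_fun ρ.1.2 (θ' ρ)
  rw [Finsupp.sum, Character.sum_apply, Character.zero_apply] at h2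
  rw [← h2]
  have hsub : ρ.1.1.support ⊆ D := fun x hx =>
    Finset.mem_union_right _ (Finset.mem_biUnion.2 ⟨ρ.1, ρ.2, hx⟩)
  refine Eq.trans (Finset.sum_subset hsub fun x _ hx => ?_).symm
    (Finset.sum_congr rfl fun x _ => (hMM _ _ _).symm)
  rw [← hMM _ _ _, Finsupp.notMem_support_iff.1 hx, zero_smul, Character.zero_apply]

end Definable

section Instances

variable {R : Type u} [Ring R]

lemma isDualAction_unop (M : Type u) [AddCommGroup M] [Module R M] :
    IsDualAction (unop : Rᵐᵒᵖ → R) M := fun _ _ _ => rfl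

lemma isDualAction_op (M : Type u) [AddCommGroup M] [Module Rᵐᵒᵖ M] :
    IsDualAction (op : R → Rᵐᵒᵖ) M := fun _ _ _ => rfl

end Instances

section Sclass

variable {R : Type u} [Ring R] {P : ModuleCat.{u} Rᵐᵒᵖ → Prop}

lemma Sclass.pureSubClosed
    (hsummand : ∀ N N' : ModuleCat.{u} Rᵐᵒᵖ, P N' → IsDirectSummand Rᵐᵒᵖ N N' → P N) :
    PureSubClosed R (Sclass P) := fun N M _ hi hM =>
  hsummand _ _ hM (hi.character_isDirectSummand (isDualAction_unop N) (isDualAction_unop M)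
    (isDualAction_op _) unop_op op_unop)

lemma Sclass.dirLimClosed (hprod : ProdClosed Rᵐᵒᵖ P)
    (hsummand : ∀ N N' : ModuleCat.{u} Rᵐᵒᵖ, P N' → IsDirectSummand Rᵐᵒᵖ N N' → P N) :
    DirLimClosed R (Sclass P) := by
  intro ι _ _ _ _ G _ _ f _ hG
  exact hsummand _ _ (hprod ι (fun i => ModuleCat.of _ (Character (G i))) hG)
    (character_directLimit_isDirectSummand f (fun i => isDualAction_unop (G i))
      (isDualAction_unop _))

lemma Sclass.directSum (hprod : ProdClosed Rᵐᵒᵖ P)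
    (hsummand : ∀ N N' : ModuleCat.{u} Rᵐᵒᵖ, P N' → IsDirectSummand Rᵐᵒᵖ N N' → P N)
    {ι : Type u} [DecidableEq ι] (X : ι → ModuleCat.{u} R) (hX : ∀ i, Sclass P (X i)) :
    Sclass P (ModuleCat.of R (⨁ i, (X i : Type u))) := by
  let E := characterDirectSumEquiv (fun i => isDualAction_unop (R := R) (X i : Type u))
    (isDualAction_unop (⨁ i, (X i : Type u)))
  exact hsummand _ _ (hprod ι (fun i => ModuleCat.of _ (Character (X i))) hX)
    ⟨E.toLinearMap, E.symm.toLinearMap, by ext1 x; exact E.symm_apply_apply x⟩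

/-- Members of `ProdSStar P` are direct summands of character modules of members of `Sclass P`. -/
lemma ProdSStar.exists_isDirectSummand (hprod : ProdClosed Rᵐᵒᵖ P)
    (hsummand : ∀ N N' : ModuleCat.{u} Rᵐᵒᵖ, P N' → IsDirectSummand Rᵐᵒᵖ N N' → P N)
    {N : ModuleCat.{u} Rᵐᵒᵖ} (hN : ProdSStar P N) :
    ∃ B : ModuleCat.{u} R, Sclass P B ∧ IsDirectSummand Rᵐᵒᵖ N (Character (B : Type u)) := by
  classical
  obtain ⟨ι, X, hX, i, π, h⟩ := hN
  let E := characterDirectSumEquiv (fun i => isDualAction_unop (R := R) (X i : Type u))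
    (isDualAction_unop (⨁ i, (X i : Type u)))
  refine ⟨_, Sclass.directSum hprod hsummand X hX, E.symm.toLinearMap.comp i,
    π.comp E.toLinearMap, LinearMap.ext fun x => ?_⟩
  show π (E (E.symm (i x))) = x
  rw [E.apply_symm_apply]
  exact DFunLike.congr_fun h x

end Sclass

theorem almost_dual_pair_Pplus_definable_tfae
    {R : Type u} [Ring R] (P : ModuleCat.{u} Rᵐᵒᵖ → Prop)
    (hiso : ∀ (N N' : ModuleCat.{u} Rᵐᵒᵖ), P N → ((N : Type u) ≃ₗ[Rᵐᵒᵖ] (N' : Type u)) → P N')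
    (hprod : ProdClosed Rᵐᵒᵖ P)
    (hsummand : ∀ (N N' : ModuleCat.{u} Rᵐᵒᵖ), P N' →
      IsDirectSummand Rᵐᵒᵖ (N : Type u) (N' : Type u) → P N)
    (hhull : ∀ N : ModuleCat.{u} Rᵐᵒᵖ, P N → ∃ N' : ModuleCat.{u} Rᵐᵒᵖ,
      P N' ∧ IsPureInjective Rᵐᵒᵖ (N' : Type u) ∧
      ∃ i : (N : Type u) →ₗ[Rᵐᵒᵖ] (N' : Type u), IsPureEmbedding Rᵐᵒᵖ i) :
    List.TFAE
      [ IsDefinable Rᵐᵒᵖ (Pplus P),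
        ∀ N : ModuleCat.{u} Rᵐᵒᵖ, P N →
          Sclass P (ModuleCat.of R (Character (N : Type u))),
        ∀ N : ModuleCat.{u} Rᵐᵒᵖ, Pplus P N →
          Sclass P (ModuleCat.of R (Character (N : Type u))),
        IsDefinable R (Sclass P) ∧
          ∀ N : ModuleCat.{u} Rᵐᵒᵖ, P N → IsPureInjective Rᵐᵒᵖ (N : Type u) → ProdSStar P N,
        IsDefinable R (Sclass P) ∧
          ∀ N : ModuleCat.{u} Rᵐᵒᵖ, Pplus P N →
            ∃ B : ModuleCat.{u} R, Sclass P B ∧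
              ∃ i : (N : Type u) →ₗ[Rᵐᵒᵖ] Character (B : Type u), IsPureEmbedding Rᵐᵒᵖ i,
        IsDefinable R (Sclass P) ∧
          ∀ N : ModuleCat.{u} Rᵐᵒᵖ,
            (ProdSStar P N ↔ (P N ∧ IsPureInjective Rᵐᵒᵖ (N : Type u))) ] := by
  have hbidual : ∀ N : ModuleCat.{u} Rᵐᵒᵖ,
      ∃ e : (N : Type u) →ₗ[Rᵐᵒᵖ] Character (Character (N : Type u)), IsPureEmbedding Rᵐᵒᵖ e :=
    fun N => by
      obtain ⟨e, -, he⟩ := (isDualAction_op (R := R) (N : Type u)).exists_pure_eval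
        (isDualAction_unop _) op_unop
      exact ⟨e, he⟩
  have hdual : ∀ {N M : ModuleCat.{u} Rᵐᵒᵖ} (i : N →ₗ[Rᵐᵒᵖ] M), IsPureEmbedding Rᵐᵒᵖ i →
      Sclass P (ModuleCat.of R (Character (M : Type u))) →
      Sclass P (ModuleCat.of R (Character (N : Type u))) := fun {N M} i hi hM => by
    obtain ⟨j, π, h⟩ := hi.character_isDirectSummand (isDualAction_op (R := R) (N : Type u))
      (isDualAction_op (M : Type u)) (isDualAction_unop _) op_unop unop_op
    exact Sclass.pureSubClosed hsummand (ModuleCat.of R (Character (N : Type u)))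
      (ModuleCat.of R (Character (M : Type u))) j (IsDirectSummand.isPureEmbedding h) hM
  have hpinj : ∀ {N N' : ModuleCat.{u} Rᵐᵒᵖ} (i : N →ₗ[Rᵐᵒᵖ] N'), IsPureEmbedding Rᵐᵒᵖ i →
      IsPureInjective Rᵐᵒᵖ N → P N' → P N := fun {N N'} i hi hN hN' => by
    obtain ⟨π, hπ⟩ := hN _ i hi
    exact hsummand _ _ hN' ⟨i, π, hπ⟩
  have hSprod : (∀ N : ModuleCat.{u} Rᵐᵒᵖ, Pplus P N →
      Sclass P (ModuleCat.of R (Character (N : Type u)))) → ProdClosed R (Sclass P) := by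
    classical
    intro h ι X hX
    obtain ⟨j, hj⟩ := exists_pure_pi_character_directSum (A := R) (B := Rᵐᵒᵖ)
      (fun i => isDualAction_unop (X i : Type u)) (fun i => isDualAction_op _)
      (isDualAction_op _) unop_op
    refine Sclass.pureSubClosed hsummand _
      (ModuleCat.of R (Character (⨁ i, Character (X i : Type u)))) j hj ?_
    exact h (ModuleCat.of Rᵐᵒᵖ (⨁ i, Character (X i : Type u)))
      ⟨_, hprod ι (fun i => ModuleCat.of _ (Character (X i : Type u))) hX, _,
        IsPureEmbedding.directSum_coe⟩
  have hSdef : (∀ N : ModuleCat.{u} Rᵐᵒᵖ, Pplus P N →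
      Sclass P (ModuleCat.of R (Character (N : Type u)))) → IsDefinable R (Sclass P) := fun h =>
    ⟨hSprod h, Sclass.dirLimClosed hprod hsummand, Sclass.pureSubClosed hsummand⟩
  tfae_have 1 → 2 := by
    intro h N hN
    obtain ⟨N', hN', i, hi⟩ := h.character_character (isDualAction_op (R := R) (N : Type u))
      (isDualAction_unop _) op_unop ⟨N, hN, _, IsPureEmbedding.id⟩
    exact hpinj i hi (isDualAction_unop (Character (N : Type u))).isPureInjective hN'
  tfae_have 2 → 3 := fun h N ⟨N', hN', i, hi⟩ => hdual i hi (h N' hN')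
  tfae_have 3 → 1 := by
    intro h
    refine ⟨fun ι X hX => ?_, ?_, fun N M i hi ⟨M', hM', j, hj⟩ => ⟨M', hM', _, hj.comp hi⟩⟩
    · choose Y hY j hj using hX
      exact ⟨_, hprod ι Y hY, _, IsPureEmbedding.pi j hj⟩
    · intro ι _ _ _ _ G _ _ f _ hG
      obtain ⟨j, π, hj⟩ := character_directLimit_isDirectSummand f
        (fun i => isDualAction_op (R := R) (G i)) (isDualAction_op _)
      obtain ⟨e, he⟩ := hbidual (ModuleCat.of Rᵐᵒᵖ (Module.DirectLimit G f))
      refine ⟨ModuleCat.of Rᵐᵒᵖ (Character (Character (Module.DirectLimit G f))), ?_, e, he⟩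
      exact Sclass.pureSubClosed hsummand
        (ModuleCat.of R (Character (Module.DirectLimit G f))) _ j
        (IsDirectSummand.isPureEmbedding hj)
        (hSprod h ι (fun i => ModuleCat.of R (Character (G i))) fun i => h _ (hG i))
  tfae_have 3 → 4 := by
    refine fun h => ⟨hSdef h, fun N hN hinj => ?_⟩
    obtain ⟨e, he⟩ := hbidual N
    obtain ⟨π, hπ⟩ := hinj _ e he
    refine ⟨PUnit, fun _ => ModuleCat.of R (Character (N : Type u)),
      fun _ => h N ⟨N, hN, _, IsPureEmbedding.id⟩, LinearMap.pi fun _ => e,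
      π.comp (LinearMap.proj PUnit.unit), hπ⟩
  tfae_have 4 → 5 := by
    refine fun ⟨hS, h⟩ => ⟨hS, fun N ⟨N', hN', i, hi⟩ => ?_⟩
    obtain ⟨N'', hN'', hinj, j, hj⟩ := hhull N' hN'
    obtain ⟨B, hB, k, π, hk⟩ := (h N'' hN'' hinj).exists_isDirectSummand hprod hsummand
    exact ⟨B, hB, _, (IsDirectSummand.isPureEmbedding hk).comp (hj.comp hi)⟩
  tfae_have 5 → 2 := by
    refine fun ⟨hS, h⟩ N hN => ?_
    obtain ⟨B, hB, i, hi⟩ := h N ⟨N, hN, _, IsPureEmbedding.id⟩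
    have hBB := hS.character_character (isDualAction_unop (B : Type u))
      (isDualAction_op _) unop_op hB
    exact hdual (M := ModuleCat.of Rᵐᵒᵖ (Character (B : Type u))) i hi hBB
  tfae_have 4 → 6 := by
    refine fun ⟨hS, h⟩ => ⟨hS, fun N => ⟨fun hN => ?_, fun hN => h N hN.1 hN.2⟩⟩
    obtain ⟨B, hB, hNB⟩ := hN.exists_isDirectSummand hprod hsummand
    exact ⟨hsummand _ _ hB hNB,
      (isDualAction_unop (B : Type u)).isPureInjective_of_isDirectSummand hNB⟩
  tfae_have 6 → 4 := fun ⟨hS, h⟩ => ⟨hS, fun N hN hinj => (h N).2 ⟨hN, hinj⟩⟩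
  tfae_finish

end
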